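/- For all integers c ≥ 2 and t ≥ 2c, every t-intersecting hypergraph on a finite vertex set admits a c-strong coloring using fewer than 2c² colors. -/

import Mathlib

open Finset in
open Classical in
/-- The p-biased measure of the family `F` restricted to subsets of `s`. -/
noncomputable def biasedM {V : Type*} (p : ℝ) (s : Finset V) (F : Finset V → Prop) : ℝ :=
  ∑ A ∈ s.powerset, if F A then p ^ A.card * (1 - p) ^ (s.card - A.card) else 0

theorem biasedM_nonneg {V : Type*} (p : ℝ) (h0 : 0 ≤ p) (h1 : p ≤ 1) (s : Finset V)
    (F : Finset V → Prop) : 0 ≤ biasedM p s F := by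
  classical
  unfold biasedM
  apply Finset.sum_nonneg
  intro A _
  have : 0 ≤ 1 - p := by linarith
  split_ifs <;> positivity

theorem biasedM_le_one {V : Type*} (p : ℝ) (h0 : 0 ≤ p) (h1 : p ≤ 1) (s : Finset V)
    (F : Finset V → Prop) : biasedM p s F ≤ 1 := by
  classical
  have h : ∑ A ∈ s.powerset, p ^ A.card * (1 - p) ^ (s.card - A.card) = 1 := by
    rw [Finset.sum_pow_mul_eq_add_pow]; simp
  rw [← h]
  unfold biasedM
  apply Finset.sum_le_sum
  intro A _
  have : 0 ≤ 1 - p := by linarith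
  split_ifs
  · exact le_rfl
  · positivity

theorem biasedM_insert {V : Type*} [DecidableEq V] (p : ℝ) (s : Finset V) (v : V) (hv : v ∉ s)
    (F : Finset V → Prop) :
    biasedM p (insert v s) F =
      (1 - p) * biasedM p s F + p * biasedM p s (fun A => F (insert v A)) := by
  classical
  unfold biasedM
  rw [Finset.sum_powerset_insert hv, Finset.mul_sum, Finset.mul_sum]
  congr 1
  · apply Finset.sum_congr rfl
    intro A hA
    have hle := Finset.card_le_card (Finset.mem_powerset.1 hA)
    rw [Finset.card_insert_of_notMem hv]
    have : s.card + 1 - A.card = (s.card - A.card) + 1 := by omega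
    rw [this]
    split_ifs
    · ring
    · ring
  · apply Finset.sum_congr rfl
    intro A hA
    have hvA : v ∉ A := fun h => hv (Finset.mem_powerset.1 hA h)
    rw [Finset.card_insert_of_notMem hv, Finset.card_insert_of_notMem hvA]
    have : s.card + 1 - (A.card + 1) = s.card - A.card := by omega
    rw [this]
    split_ifs
    · ring
    · ring

theorem key_ineq (p q Q a0 a1 b0 b1 : ℝ) (h0 : 0 ≤ p) (h1 : p ≤ 1)
    (hb0 : 0 ≤ b0)
    (hq : p ^ 2 = (1 - p) ^ 2 * q) (hT : 0 ≤ q * Q)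
    (h00 : a0 * b0 ≤ q * Q) (h01 : a0 * b1 ≤ q * Q) (h10 : a1 * b0 ≤ q * Q)
    (ha1 : 0 ≤ a1) (h11 : a1 * b1 ≤ Q) :
    ((1 - p) * a0 + p * a1) * ((1 - p) * b0 + p * b1) ≤ q * Q := by
  have hp : 0 ≤ 1 - p := by linarith
  have e : ((1 - p) * a0 + p * a1) * ((1 - p) * b0 + p * b1) =
    (1 - p) ^ 2 * (a0 * b0) + p * (1 - p) * (a0 * b1) + p * (1 - p) * (a1 * b0)
      + p ^ 2 * (a1 * b1) := by ring
  rw [e]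
  have k01 := mul_le_mul_of_nonneg_left h01 (mul_nonneg h0 hp)
  have k10 := mul_le_mul_of_nonneg_left h10 (mul_nonneg h0 hp)
  rcases le_or_gt (a1 * b1) (q * Q) with hx | hx
  · have k00 := mul_le_mul_of_nonneg_left h00 (pow_nonneg hp 2)
    have k11 := mul_le_mul_of_nonneg_left hx (pow_nonneg h0 2)
    nlinarith
  · have hxp : 0 < a1 * b1 := lt_of_le_of_lt hT hx
    have hw : (a0 * b0) * (a1 * b1) ≤ (q * Q) * (q * Q) := by
      calc (a0 * b0) * (a1 * b1) = (a0 * b1) * (a1 * b0) := by ring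
        _ ≤ _ := mul_le_mul h01 h10 (mul_nonneg ha1 hb0) hT
    generalize hTd : q * Q = T at *
    generalize a1 * b1 = x at *
    generalize a0 * b0 = w at *
    have hz : p ^ 2 * x ≤ (1 - p) ^ 2 * T := by
      have := mul_le_mul_of_nonneg_left h11 (pow_nonneg h0 2)
      have e2 : p ^ 2 * Q = (1 - p) ^ 2 * T := by rw [hq, ← hTd]; ring
      linarith
    have k1 : (1 - p) ^ 2 * (w * x) ≤ (1 - p) ^ 2 * (T * T) :=
      mul_le_mul_of_nonneg_left hw (pow_nonneg hp 2)
    have k2 : 0 ≤ (x - T) * ((1 - p) ^ 2 * T - p ^ 2 * x) :=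
      mul_nonneg (by linarith) (by linarith)
    have k3 : (1 - p) ^ 2 * w + p ^ 2 * x ≤ ((1 - p) ^ 2 + p ^ 2) * T := by
      refine le_of_mul_le_mul_right ?_ hxp
      linarith
    linarith

theorem cross_bound {V : Type*} [DecidableEq V] (p q : ℝ) (h0 : 0 ≤ p) (h1 : p ≤ 1)
    (hq0 : 0 ≤ q) (hq : p ^ 2 = (1 - p) ^ 2 * q) (s : Finset V) :
    ∀ (t : ℕ) (F G : Finset V → Prop),
      (∀ A ⊆ s, ∀ B ⊆ s, F A → G B → t ≤ (A ∩ B).card) →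
      biasedM p s F * biasedM p s G ≤ q ^ t := by
  induction s using Finset.induction_on with
  | empty =>
    intro t F G h
    rcases t with _ | t
    · rw [pow_zero]
      exact mul_le_one₀ (biasedM_le_one p h0 h1 _ _) (biasedM_nonneg p h0 h1 _ _)
        (biasedM_le_one p h0 h1 _ _)
    · have h' := h ∅ (by simp) ∅ (by simp)
      have hn : ¬ (F ∅ ∧ G ∅) := fun hh => by simpa using h' hh.1 hh.2
      have hz : biasedM p ∅ F * biasedM p ∅ G = 0 := by
        unfold biasedM
        by_cases hF : F ∅
        · have hG : ¬ G ∅ := fun hG => hn ⟨hF, hG⟩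
          simp [hG]
        · simp [hF]
      rw [hz]; positivity
  | insert v s hv ih =>
    intro t F G h
    rcases t with _ | t
    · rw [pow_zero]
      exact mul_le_one₀ (biasedM_le_one p h0 h1 _ _) (biasedM_nonneg p h0 h1 _ _)
        (biasedM_le_one p h0 h1 _ _)
    · have sub : ∀ {A : Finset V}, A ⊆ s → A ⊆ insert v s := fun hA =>
        hA.trans (Finset.subset_insert _ _)
      have sub' : ∀ {A : Finset V}, A ⊆ s → insert v A ⊆ insert v s := fun hA =>
        Finset.insert_subset_insert _ hA
      have nm : ∀ {A : Finset V}, A ⊆ s → v ∉ A := fun hA hh => hv (hA hh)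
      rw [biasedM_insert p s v hv, biasedM_insert p s v hv, pow_succ']
      apply key_ineq p q (q ^ t) _ _ _ _ h0 h1
        (biasedM_nonneg p h0 h1 _ _) hq (by positivity)
      · rw [← pow_succ']
        apply ih
        intro A hA B hB hFA hGB
        exact h A (sub hA) B (sub hB) hFA hGB
      · rw [← pow_succ']
        apply ih
        intro A hA B hB hFA hGB
        have := h A (sub hA) _ (sub' hB) hFA hGB
        rwa [Finset.inter_insert_of_notMem (nm hA)] at this
      · rw [← pow_succ']
        apply ih
        intro A hA B hB hFA hGB
        have := h _ (sub' hA) B (sub hB) hFA hGB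
        rwa [Finset.insert_inter_of_notMem (nm hB)] at this
      · exact biasedM_nonneg p h0 h1 _ _
      · apply ih
        intro A hA B hB hFA hGB
        have := h _ (sub' hA) _ (sub' hB) hFA hGB
        rw [← Finset.insert_inter_distrib, Finset.card_insert_of_notMem] at this
        · omega
        · exact fun hh => nm hA (Finset.mem_inter.1 hh).1

theorem le_of_sq_le_sq_aux (a b : ℝ) (h : a ^ 2 ≤ b ^ 2) (hb : 0 ≤ b) : a ≤ b :=
  by nlinarith

open Classical in
theorem count_eq {V : Type*} [Fintype V] (l : ℕ) (hl : 0 < l) (S : Finset (Fin l))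
    (F : Finset V → Prop) :
    (((Finset.univ : Finset (V → Fin l)).filter
      (fun f => F (Finset.univ.filter (fun v => f v ∈ S)))).card : ℝ) =
      (l : ℝ) ^ (Fintype.card V) * biasedM ((S.card : ℝ) / l) (Finset.univ : Finset V) F := by
  have hl' : (l : ℝ) ≠ 0 := by positivity
  have hfib : ∀ A : Finset V,
      (((Finset.univ : Finset (V → Fin l)).filter
        (fun f => Finset.univ.filter (fun v => f v ∈ S) = A)).card : ℝ) =
      (S.card : ℝ) ^ A.card * ((l : ℝ) - S.card) ^ (Fintype.card V - A.card) := by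
    intro A
    have : (Finset.univ : Finset (V → Fin l)).filter
        (fun f => Finset.univ.filter (fun v => f v ∈ S) = A) =
        Fintype.piFinset (fun v => if v ∈ A then S else Sᶜ) := by
      ext f
      simp only [Finset.mem_filter, Finset.mem_univ, true_and, Fintype.mem_piFinset,
        Finset.ext_iff]
      apply forall_congr'
      intro v
      by_cases hv : v ∈ A <;> simp [hv]
    rw [this, Fintype.card_piFinset]
    have e : ∀ v, (if v ∈ A then S else Sᶜ).card = if v ∈ A then S.card else Sᶜ.card := by
      intro v; split_ifs <;> rfl
    simp only [e]
    rw [Finset.prod_ite]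
    have hS : ((Sᶜ.card : ℕ) : ℝ) = (l : ℝ) - S.card := by
      rw [Finset.card_compl, Fintype.card_fin, Nat.cast_sub]
      simpa using Finset.card_le_univ S
    have hA : (Finset.univ.filter (fun v => v ∉ A)).card = Fintype.card V - A.card := by
      rw [← Finset.card_compl]; congr 1; ext; simp
    simp [hS, hA]
  rw [Finset.card_eq_sum_card_fiberwise
    (f := fun f : V → Fin l => Finset.univ.filter (fun v => f v ∈ S))
    (t := (Finset.univ : Finset V).powerset) (by intro f _; simp)]
  unfold biasedM
  rw [Finset.mul_sum, Nat.cast_sum]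
  apply Finset.sum_congr rfl
  intro A _
  rw [Finset.filter_filter]
  split_ifs with hF
  · have : ∀ f : V → Fin l, (F (Finset.univ.filter (fun v => f v ∈ S)) ∧
        Finset.univ.filter (fun v => f v ∈ S) = A) ↔
        Finset.univ.filter (fun v => f v ∈ S) = A := by
      intro f
      exact ⟨fun h => h.2, fun h => ⟨by rw [h]; exact hF, h⟩⟩
    simp only [this]
    rw [hfib A, Finset.card_univ]
    have hle : A.card ≤ Fintype.card V := Finset.card_le_univ A
    have e1 : (1 : ℝ) - (S.card : ℝ) / l = ((l : ℝ) - S.card) / l := by field_simp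
    have e2 : (l : ℝ) ^ (Fintype.card V) = (l : ℝ) ^ A.card * (l : ℝ) ^ (Fintype.card V - A.card) := by
      rw [← pow_add]; congr 1; omega
    rw [e1, e2, div_pow, div_pow]
    field_simp
  · rw [mul_zero, Nat.cast_eq_zero, Finset.card_eq_zero, Finset.filter_eq_empty_iff]
    rintro f _ ⟨h1, h2⟩
    rw [h2] at h1
    exact hF h1

/-- For all c ≥ 2 and t ≥ 2c, every t-intersecting hypergraph on a finite vertex set
has a c-strong coloring using fewer than 2c² colors. -/
theorem stmt_19 (c t : ℕ) (hc : 2 ≤ c) (ht : 2 * c ≤ t)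
    {V : Type*} [Fintype V] [DecidableEq V] (E : Set (Finset V))
    (hE : ∀ e₁ ∈ E, ∀ e₂ ∈ E, t ≤ (e₁ ∩ e₂).card) :
    ∃ ℓ : ℕ, ℓ < 2 * c ^ 2 ∧
      ∃ f : V → Fin ℓ, ∀ e ∈ E, min c e.card ≤ (e.image f).card := by
  classical
  obtain ⟨d, rfl⟩ : ∃ d, c = d + 1 := ⟨c - 1, by omega⟩
  have hd : 1 ≤ d := by omega
  obtain ⟨l, hl⟩ : ∃ l, l + 1 = 2 * (d + 1) ^ 2 :=
    ⟨2 * (d + 1) ^ 2 - 1, Nat.sub_add_cancel (by nlinarith)⟩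
  refine ⟨l, by omega, ?_⟩
  by_contra! hcon
  have hdl : d ≤ l := by nlinarith
  have hl0 : 0 < l := by omega
  let F : Finset V → Prop := fun A => ∃ e ∈ E, e ⊆ A
  let bad : Finset (Fin l) → Finset (V → Fin l) := fun S =>
    (Finset.univ : Finset (V → Fin l)).filter
      (fun f => F (Finset.univ.filter (fun v => f v ∈ S)))
  have hcover : (Finset.univ : Finset (V → Fin l)) ⊆
      (Finset.powersetCard d (Finset.univ : Finset (Fin l))).biUnion bad := by
    intro f _
    obtain ⟨e, he, hlt⟩ := hcon f
    have hle : (e.image f).card ≤ d := by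
      have := lt_of_lt_of_le hlt (min_le_left _ _); omega
    obtain ⟨S, hS, hScard⟩ := Finset.exists_superset_card_eq hle (by simpa using hdl)
    simp only [Finset.mem_biUnion, Finset.mem_powersetCard, bad, Finset.mem_filter,
      Finset.mem_univ, true_and]
    refine ⟨S, ⟨Finset.subset_univ _, hScard⟩, e, he, ?_⟩
    intro v hv
    simp only [Finset.mem_filter, Finset.mem_univ, true_and]
    exact hS (Finset.mem_image_of_mem f hv)
  have hlR : (l : ℝ) = 2 * ((d : ℝ) + 1) ^ 2 - 1 := by
    have : ((l + 1 : ℕ) : ℝ) = ((2 * (d + 1) ^ 2 : ℕ) : ℝ) := by rw [hl]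
    push_cast at this; linarith
  have hdR : (1 : ℝ) ≤ d := by exact_mod_cast hd
  have hlpos : (0 : ℝ) < l := by exact_mod_cast hl0
  have hmpos : (0 : ℝ) < (l : ℝ) - d := by rw [hlR]; nlinarith
  set r : ℝ := (d : ℝ) / ((l : ℝ) - d) with hr
  have hr0 : 0 ≤ r := by positivity
  have hr1 : r ≤ 1 / (2 * ((d : ℝ) + 1)) := by
    rw [hr, div_le_div_iff₀ hmpos (by positivity), hlR]; nlinarith
  have hbad : ∀ S ∈ Finset.powersetCard d (Finset.univ : Finset (Fin l)),
      ((bad S).card : ℝ) ≤ (l : ℝ) ^ (Fintype.card V) * r ^ (2 * (d + 1)) := by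
    intro S hS
    have hScard : S.card = d := (Finset.mem_powersetCard.1 hS).2
    have hce := count_eq l hl0 S F
    rw [hScard] at hce
    have hp0 : 0 ≤ (d : ℝ) / l := by positivity
    have hp1 : (d : ℝ) / l ≤ 1 := by rw [div_le_one hlpos]; linarith
    have hcb := cross_bound ((d : ℝ) / l) (r ^ 2) hp0 hp1 (by positivity)
      (by rw [hr]; field_simp) (Finset.univ : Finset V) (2 * (d + 1)) F F (by
        rintro A _ B _ ⟨e, he, heA⟩ ⟨e', he', heB⟩
        exact (ht.trans (hE e he e' he')).trans
          (Finset.card_le_card (Finset.inter_subset_inter heA heB)))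
    have hM : biasedM ((d : ℝ) / l) (Finset.univ : Finset V) F ≤ r ^ (2 * (d + 1)) := by
      refine le_of_sq_le_sq_aux _ _ ?_ (by positivity)
      rw [sq, ← pow_mul, mul_comm (2 * (d + 1)) 2, pow_mul]
      exact hcb
    calc ((bad S).card : ℝ) = (l : ℝ) ^ (Fintype.card V) *
          biasedM ((d : ℝ) / l) (Finset.univ : Finset V) F := by
            rw [← hce]; simp only [bad]; congr!
      _ ≤ _ := mul_le_mul_of_nonneg_left hM (by positivity)
  have h1 := (Finset.card_le_card hcover).trans Finset.card_biUnion_le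
  have h2 : (l : ℝ) ^ (Fintype.card V) ≤
      (l.choose d : ℝ) * ((l : ℝ) ^ (Fintype.card V) * r ^ (2 * (d + 1))) := by
    calc (l : ℝ) ^ (Fintype.card V)
        = ((Finset.univ : Finset (V → Fin l)).card : ℝ) := by simp
      _ ≤ ∑ S ∈ Finset.powersetCard d (Finset.univ : Finset (Fin l)), ((bad S).card : ℝ) := by
          exact_mod_cast h1
      _ ≤ ∑ S ∈ Finset.powersetCard d (Finset.univ : Finset (Fin l)),
            (l : ℝ) ^ (Fintype.card V) * r ^ (2 * (d + 1)) := Finset.sum_le_sum hbad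
      _ = _ := by simp
  have h3 : (l.choose d : ℝ) * r ^ (2 * (d + 1)) < 1 := by
    have a1 : (l.choose d : ℝ) ≤ (l : ℝ) ^ d := by exact_mod_cast Nat.choose_le_pow l d
    have a2 : r ^ (2 * (d + 1)) ≤ (1 / (2 * ((d : ℝ) + 1))) ^ (2 * (d + 1)) :=
      pow_le_pow_left₀ hr0 hr1 _
    have a3 : (l : ℝ) ^ d < ((2 * ((d : ℝ) + 1)) ^ 2) ^ (d + 1) := by
      calc (l : ℝ) ^ d ≤ ((2 * ((d : ℝ) + 1)) ^ 2) ^ d :=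
            pow_le_pow_left₀ hlpos.le (by rw [hlR]; nlinarith) _
        _ < _ := pow_lt_pow_right₀ (by nlinarith) (by omega)
    calc (l.choose d : ℝ) * r ^ (2 * (d + 1))
        ≤ (l : ℝ) ^ d * (1 / (2 * ((d : ℝ) + 1))) ^ (2 * (d + 1)) :=
          mul_le_mul a1 a2 (by positivity) (by positivity)
      _ < 1 := by
          rw [one_div, inv_pow, ← div_eq_mul_inv, div_lt_one (by positivity), pow_mul]
          exact a3
  have hpos : (0 : ℝ) < (l : ℝ) ^ (Fintype.card V) := by positivity
  nlinarith [mul_lt_mul_of_pos_left h3 hpos]
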